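/- (Abelian property / equivalence of methods A and B.) Let σ and τ be two legal sequences of Engel moves starting from the same configuration c, containing the same number of type-2 moves, and suppose that no type-1 move is legal in the configuration obtained after σ and none is legal in the configuration obtained after τ. Then for every transient state t, σ and τ contain the same number of type-1 moves at t, and the final configurations reached by σ and by τ are equal. -/

import Mathlib

/-- A move in Engel's chip game: a type-1 move fires the transient state `i`,
a type-2 move adds a single chip at the distinguished starting state. -/
inductive EngelMove (s : ℕ) where
  | type1 (i : Fin s) : EngelMove s
  | type2 : EngelMove s
deriving DecidableEq

/-- The effect of a move on a configuration of chips: a type-1 move at `i` removes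
`ri i` chips from `i` and sends `rij i j` chips to each state `j`; a type-2 move adds
one chip at the distinguished state `u`. -/
def engelApply {s : ℕ} (u : Fin s) (ri : Fin s → ℕ) (rij : Fin s → Fin s → ℕ) :
    EngelMove s → (Fin s → ℕ) → (Fin s → ℕ)
  | .type1 i, c => fun j => c j - (if j = i then ri i else 0) + rij i j
  | .type2, c => fun j => c j + (if j = u then 1 else 0)

/-- Legality of a move in a configuration (`r` = number of transient states):
a type-1 move at `i` is legal iff `i` is transient and carries at least `ri i` chips;
type-2 moves are always allowed. -/
def engelLegal {s : ℕ} (r : ℕ) (ri : Fin s → ℕ) :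
    EngelMove s → (Fin s → ℕ) → Prop
  | .type1 i, c => (i : ℕ) < r ∧ ri i ≤ c i
  | .type2, _ => True

/-- A list of moves is a legal sequence from a configuration if every type-1 move in it
is legal in the configuration at which it is performed. -/
def engelLegalSeq {s : ℕ} (r : ℕ) (u : Fin s) (ri : Fin s → ℕ)
    (rij : Fin s → Fin s → ℕ) : (Fin s → ℕ) → List (EngelMove s) → Prop
  | _, [] => True
  | c, m :: ms => engelLegal r ri m c ∧
      engelLegalSeq r u ri rij (engelApply u ri rij m c) ms

/-- The configuration obtained after performing a list of moves. -/
def engelRun {s : ℕ} (u : Fin s) (ri : Fin s → ℕ) (rij : Fin s → Fin s → ℕ)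
    (c : Fin s → ℕ) (ms : List (EngelMove s)) : Fin s → ℕ :=
  ms.foldl (fun c m => engelApply u ri rij m c) c

theorem engelRun_append_singleton {s : ℕ} (u : Fin s) (ri : Fin s → ℕ)
    (rij : Fin s → Fin s → ℕ) (c : Fin s → ℕ) (ms : List (EngelMove s)) (m : EngelMove s) :
    engelRun u ri rij c (ms ++ [m]) = engelApply u ri rij m (engelRun u ri rij c ms) := by
  simp [engelRun]

theorem engelLegalSeq_append_singleton {s : ℕ} (r : ℕ) (u : Fin s) (ri : Fin s → ℕ)
    (rij : Fin s → Fin s → ℕ) (c : Fin s → ℕ) (ms : List (EngelMove s)) (m : EngelMove s) :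
    engelLegalSeq r u ri rij c (ms ++ [m]) ↔
      engelLegalSeq r u ri rij c ms ∧ engelLegal r ri m (engelRun u ri rij c ms) := by
  induction ms generalizing c with
  | nil => simp [engelLegalSeq, engelRun]
  | cons a ms ih =>
    simp only [List.cons_append, engelLegalSeq, ih, and_assoc]
    rfl

/-- Chip balance along a legal sequence: the final number of chips at `j` plus the number of
chips fired from `j` is the initial number plus the number of chips received by `j`. -/
theorem engelRun_balance {s : ℕ} {r : ℕ} {u : Fin s} {ri : Fin s → ℕ}
    {rij : Fin s → Fin s → ℕ} {c : Fin s → ℕ} {ms : List (EngelMove s)}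
    (h : engelLegalSeq r u ri rij c ms) (j : Fin s) :
    engelRun u ri rij c ms j + ms.count (EngelMove.type1 j) * ri j =
      c j + ∑ i, ms.count (EngelMove.type1 i) * rij i j +
        (if j = u then ms.count EngelMove.type2 else 0) := by
  induction ms using List.reverseRecOn with
  | nil => simp [engelRun]
  | append_singleton ms m ih =>
    rw [engelLegalSeq_append_singleton] at h
    have ih' := ih h.1
    rw [engelRun_append_singleton]
    cases m with
    | type1 i =>
      have hle : ri i ≤ engelRun u ri rij c ms i := h.2.2
      have hsum : ∑ k, (ms ++ [EngelMove.type1 i]).count (EngelMove.type1 k) * rij k j =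
          ∑ k, ms.count (EngelMove.type1 k) * rij k j + rij i j := by
        simp [List.count_singleton, add_mul, Finset.sum_add_distrib]
      rw [hsum]
      by_cases hj : j = i
      · subst hj
        simp only [engelApply, List.count_append, List.count_singleton]
        simp only [if_true, beq_self_eq_true, add_mul, one_mul, reduceCtorEq, beq_iff_eq,
          if_false, add_zero]
        omega
      · simp only [engelApply, List.count_append, List.count_singleton, beq_iff_eq,
          EngelMove.type1.injEq, reduceCtorEq, if_false, add_zero, hj, Ne.symm hj]
        omega
    | type2 =>
      simp only [engelApply, List.count_append, List.count_singleton, beq_iff_eq,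
        reduceCtorEq, if_false, add_zero, if_true]
      split_ifs at ih' ⊢ <;> omega

/-- Least action principle: a legal sequence fires no state more often than a legal sequence
that ends in a stable configuration and adds at least as many chips. -/
theorem engel_count_le_of_stable {s : ℕ} {r : ℕ} {u : Fin s} {ri : Fin s → ℕ}
    {rij : Fin s → Fin s → ℕ} {c : Fin s → ℕ} {σ τ : List (EngelMove s)}
    (hσ : engelLegalSeq r u ri rij c σ) (hτ : engelLegalSeq r u ri rij c τ)
    (hcount : τ.count EngelMove.type2 ≤ σ.count EngelMove.type2)
    (hfinal : ∀ i : Fin s, ¬ engelLegal r ri (EngelMove.type1 i) (engelRun u ri rij c σ))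
    (t : Fin s) : τ.count (EngelMove.type1 t) ≤ σ.count (EngelMove.type1 t) := by
  induction τ using List.reverseRecOn generalizing t with
  | nil => simp
  | append_singleton τ m ih =>
    rw [engelLegalSeq_append_singleton] at hτ
    rw [List.count_append] at hcount ⊢
    have ih' := ih hτ.1 (by omega)
    by_cases hm : m = EngelMove.type1 t
    · subst hm
      have hlt : τ.count (EngelMove.type1 t) ≠ σ.count (EngelMove.type1 t) := by
        intro heq
        refine hfinal t ⟨hτ.2.1, hτ.2.2.trans ?_⟩
        have hbσ := engelRun_balance hσ t
        have hbτ := engelRun_balance hτ.1 t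
        have hsum : ∑ i, τ.count (EngelMove.type1 i) * rij i t ≤
            ∑ i, σ.count (EngelMove.type1 i) * rij i t :=
          Finset.sum_le_sum fun i _ => Nat.mul_le_mul_right _ (ih' i)
        rw [heq] at hbτ
        split_ifs at hbσ hbτ <;> omega
      have := ih' t
      rw [List.count_singleton_self]
      omega
    · rw [List.count_eq_zero_of_not_mem (l := [m]) (by simpa using Ne.symm hm)]
      exact ih' t

/-- **abelian property / equivalence of methods A and B.** If `σ` and `τ`
are legal sequences of Engel moves from the same configuration `c` containing the same
number of type-2 moves, and no type-1 move is legal after `σ` nor after `τ`, then `σ`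
and `τ` contain the same number of type-1 moves at each transient state, and they reach
the same final configuration. -/
theorem engel_abelian_property
    (r s : ℕ) (hr : 1 ≤ r) (hrs : r < s)
    (u : Fin s) (hu : (u : ℕ) < r)
    (ri : Fin s → ℕ) (hri : ∀ i : Fin s, (i : ℕ) < r → 0 < ri i)
    (rij : Fin s → Fin s → ℕ)
    (hsum : ∀ i : Fin s, (i : ℕ) < r → ∑ j, rij i j = ri i)
    (c : Fin s → ℕ) (σ τ : List (EngelMove s))
    (hσ : engelLegalSeq r u ri rij c σ)
    (hτ : engelLegalSeq r u ri rij c τ)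
    (hcount2 : σ.count EngelMove.type2 = τ.count EngelMove.type2)
    (hσfinal : ∀ i : Fin s,
      ¬ engelLegal r ri (EngelMove.type1 i) (engelRun u ri rij c σ))
    (hτfinal : ∀ i : Fin s,
      ¬ engelLegal r ri (EngelMove.type1 i) (engelRun u ri rij c τ)) :
    (∀ t : Fin s, (t : ℕ) < r →
      σ.count (EngelMove.type1 t) = τ.count (EngelMove.type1 t)) ∧
    engelRun u ri rij c σ = engelRun u ri rij c τ := by
  have hc : ∀ t, σ.count (EngelMove.type1 t) = τ.count (EngelMove.type1 t) := fun t =>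
    le_antisymm (engel_count_le_of_stable hτ hσ hcount2.le hτfinal t)
      (engel_count_le_of_stable hσ hτ hcount2.ge hσfinal t)
  refine ⟨fun t _ => hc t, funext fun j => ?_⟩
  have hbσ := engelRun_balance hσ j
  have hbτ := engelRun_balance hτ j
  simp only [hc, hcount2] at hbσ
  omega
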